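/- arXiv:2501.02181 — 4 statements merged into one kernel-verified Lean document; each statement's English description precedes it below -/
import Mathlib

section
/- Let B be a positive integer and let ψ ∈ (0,1) satisfy (B+1)(1-ψ) > 1. Then the equation (1-ψ)·ξ^(B+1) - ξ + ψ = 0 has exactly one solution ξ in the open interval (0,1). -/
theorem strictMonoOn_geom_sum {B : ℕ} (hB : 0 < B) :
    StrictMonoOn (fun x : ℝ => ∑ i ∈ Finset.range (B + 1), x ^ i) (Set.Ici 0) := by
  intro x hx y _ hxy
  refine Finset.sum_lt_sum (fun i _ => pow_le_pow_left₀ hx hxy.le i) ⟨1, ?_, by simpa using hxy⟩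
  simpa using hB

theorem mul_pow_succ_sub_add_eq_zero_iff {B : ℕ} {ψ x : ℝ} (hx : x ≠ 1) :
    (1 - ψ) * x ^ (B + 1) - x + ψ = 0 ↔
      (1 - ψ) * ∑ i ∈ Finset.range (B + 1), x ^ i = 1 := by
  have hfactor : (1 - ψ) * x ^ (B + 1) - x + ψ =
      (x - 1) * ((1 - ψ) * ∑ i ∈ Finset.range (B + 1), x ^ i - 1) := by
    linear_combination -(1 - ψ) * geom_sum_mul x (B + 1)
  rw [hfactor, mul_eq_zero, or_iff_right (sub_ne_zero.mpr hx), sub_eq_zero]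

/-- Let B be a positive integer and ψ ∈ (0,1) with (B+1)(1-ψ) > 1. Then
(1-ψ)·ξ^(B+1) - ξ + ψ = 0 has exactly one solution ξ in (0,1). -/
theorem stmt_0 (B : ℕ) (hB : 0 < B) (ψ : ℝ) (hψ0 : 0 < ψ) (hψ1 : ψ < 1)
    (hstab : (B + 1 : ℝ) * (1 - ψ) > 1) :
    ∃! ξ : ℝ, ξ ∈ Set.Ioo (0 : ℝ) 1 ∧ (1 - ψ) * ξ ^ (B + 1) - ξ + ψ = 0 := by
  have hcont : Continuous fun x : ℝ => (1 - ψ) * ∑ i ∈ Finset.range (B + 1), x ^ i := by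
    fun_prop
  obtain ⟨ξ, hξ, hroot⟩ := intermediate_value_Ioo zero_le_one hcont.continuousOn
    (show (1 : ℝ) ∈ Set.Ioo _ _ by
      refine ⟨?_, ?_⟩
      · simpa [Finset.sum_range_succ'] using hψ0
      · simpa [mul_comm] using hstab)
  refine ⟨ξ, ⟨hξ, (mul_pow_succ_sub_add_eq_zero_iff hξ.2.ne).mpr hroot⟩, ?_⟩
  rintro η ⟨hη, hη_root⟩
  rw [mul_pow_succ_sub_add_eq_zero_iff hη.2.ne] at hη_root
  exact (strictMonoOn_geom_sum hB).injOn hη.1.le hξ.1.le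
    (mul_left_cancel₀ (sub_pos.mpr hψ1).ne' (hη_root.trans hroot.symm))
end

section
/- Let B be a positive integer and, for i = 1,2, let λ_i, μ_i > 0 satisfy λ_1/μ_1 = λ_2/μ_2 and λ_i < B·μ_i. Set ψ_i = λ_i/(λ_i+μ_i), let ξ_i ∈ (0,1) satisfy (1-ψ_i)·ξ_i^(B+1) - ξ_i + ψ_i = 0, and set χ_i = λ_i/μ_i and r_i = ξ_i/(1-ξ_i). For q ∈ ℕ define D_q^(i) = q·(½(q+1) + χ_i - r_i) - r_i²·ξ_i^q + r_i·(r_i - χ_i). Then D_q^(1) = D_q^(2) for every q ∈ ℕ. -/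
/-- A trinomial `c * x ^ n - x + d` vanishing at `1`, with `0 < c` and `2 ≤ n`, has no two
distinct ordered roots in `[0, 1)`, by strict convexity of `x ↦ x ^ n`. -/
theorem not_lt_of_trinomial_roots {n : ℕ} (hn : 2 ≤ n) {c d x y : ℝ} (hc : 0 < c)
    (hone : c - 1 + d = 0) (hx : 0 ≤ x) (hy : y < 1)
    (hxr : c * x ^ n - x + d = 0) (hyr : c * y ^ n - y + d = 0) : ¬ x < y := by
  intro hxy
  have hslope := (strictConvexOn_pow hn).slope_strict_mono_adjacent
    (Set.mem_Ici.2 hx) (Set.mem_Ici.2 zero_le_one) hxy hy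
  have hleft : (y ^ n - x ^ n) / (y - x) = 1 / c := by
    rw [div_eq_div_iff (sub_pos.2 hxy).ne' hc.ne']
    linear_combination hyr - hxr
  have hright : ((1 : ℝ) ^ n - y ^ n) / (1 - y) = 1 / c := by
    rw [one_pow, div_eq_div_iff (sub_pos.2 hy).ne' hc.ne']
    linear_combination hone - hyr
  exact lt_irrefl _ (hleft ▸ hright ▸ hslope)

/-- The trinomial `c * x ^ n - x + d` vanishing at `1`, with `0 < c` and `2 ≤ n`, has at most one
root in `[0, 1)`. -/
theorem trinomial_root_unique {n : ℕ} (hn : 2 ≤ n) {c d x y : ℝ} (hc : 0 < c)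
    (hone : c - 1 + d = 0) (hx : x ∈ Set.Ico (0 : ℝ) 1) (hy : y ∈ Set.Ico (0 : ℝ) 1)
    (hxr : c * x ^ n - x + d = 0) (hyr : c * y ^ n - y + d = 0) : x = y :=
  le_antisymm (not_lt.1 (not_lt_of_trinomial_roots hn hc hone hy.1 hx.2 hyr hxr))
    (not_lt.1 (not_lt_of_trinomial_roots hn hc hone hx.1 hy.2 hxr hyr))


/-- Corollary 1: with the term w₂ζ₀λ²/w₁ equal to zero, the quantities D_q in
Proposition 4 depend only on the ratio χ = λ/μ and on B. -/
theorem stmt_1 (B : ℕ) (hB : 0 < B)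
    (lam₁ mu₁ lam₂ mu₂ : ℝ)
    (hlam₁ : 0 < lam₁) (hmu₁ : 0 < mu₁) (hlam₂ : 0 < lam₂) (hmu₂ : 0 < mu₂)
    (hratio : lam₁ / mu₁ = lam₂ / mu₂)
    (hstab₁ : lam₁ < B * mu₁) (hstab₂ : lam₂ < B * mu₂)
    (ξ₁ ξ₂ : ℝ) (hξ₁ : ξ₁ ∈ Set.Ioo (0 : ℝ) 1) (hξ₂ : ξ₂ ∈ Set.Ioo (0 : ℝ) 1)
    (hroot₁ : (1 - lam₁ / (lam₁ + mu₁)) * ξ₁ ^ (B + 1) - ξ₁ + lam₁ / (lam₁ + mu₁) = 0)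
    (hroot₂ : (1 - lam₂ / (lam₂ + mu₂)) * ξ₂ ^ (B + 1) - ξ₂ + lam₂ / (lam₂ + mu₂) = 0) :
    ∀ q : ℕ,
      (q : ℝ) * ((1 / 2) * (q + 1) + lam₁ / mu₁ - ξ₁ / (1 - ξ₁))
          - (ξ₁ / (1 - ξ₁)) ^ 2 * ξ₁ ^ q
          + (ξ₁ / (1 - ξ₁)) * (ξ₁ / (1 - ξ₁) - lam₁ / mu₁)
        =
      (q : ℝ) * ((1 / 2) * (q + 1) + lam₂ / mu₂ - ξ₂ / (1 - ξ₂))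
          - (ξ₂ / (1 - ξ₂)) ^ 2 * ξ₂ ^ q
          + (ξ₂ / (1 - ξ₂)) * (ξ₂ / (1 - ξ₂) - lam₂ / mu₂) := by
  have hψ : lam₂ / (lam₂ + mu₂) = lam₁ / (lam₁ + mu₁) := by
    rw [div_eq_div_iff hmu₁.ne' hmu₂.ne'] at hratio
    rw [div_eq_div_iff (by positivity) (by positivity)]
    linear_combination -hratio
  rw [hψ] at hroot₂
  have hc : 0 < 1 - lam₁ / (lam₁ + mu₁) := by
    rw [sub_pos, div_lt_one (by positivity)]
    linarith
  have hξ : ξ₁ = ξ₂ := trinomial_root_unique (by omega) hc (by ring)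
    (Set.Ioo_subset_Ico_self hξ₁) (Set.Ioo_subset_Ico_self hξ₂) hroot₁ hroot₂
  intro q
  rw [hξ, hratio]
end

section
/- Let S be a finite nonempty state space and A a finite action space; for each s ∈ S let A_s ⊆ A be a nonempty set of feasible actions; let c(s,a) ∈ ℝ be expected costs, y(s,a) > 0 expected sojourn times, and m(j|s,a) ≥ 0 with ∑_{j∈S} m(j|s,a) = 1 transition probabilities. Suppose g ∈ ℝ and h : S → ℝ satisfy the SMDP optimality equations h(s) = min_{a ∈ A_s} { c(s,a) - g·y(s,a) + ∑_{j∈S} m(j|s,a)·h(j) } for all s ∈ S. Let π : S → A be any stationary policy with π(s) ∈ A_s for all s, and let μ : S → ℝ satisfy μ(s) ≥ 0, ∑_s μ(s) = 1, and the invariance condition ∑_s μ(s)·m(j|s,π(s)) = μ(j) for all j ∈ S. Then g·∑_s μ(s)·y(s,π(s)) ≤ ∑_s μ(s)·c(s,π(s)); in particular, since ∑_s μ(s)·y(s,π(s)) > 0, g is at most the long-run average cost per unit time (∑_s μ(s)·c(s,π(s)))/(∑_s μ(s)·y(s,π(s))) of the policy π. -/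
open Finset

/-- Verification (lower-bound) half of Proposition 2 in the finite-state setting:
a solution (g, h) of the average-cost SMDP optimality equations lower-bounds the
average expected cost per unit time of every stationary policy with a stationary
distribution. -/
theorem stmt_9 {S A : Type*} [Fintype S] [Nonempty S] [Fintype A]
    (Afeas : S → Finset A) (hAfeas : ∀ s, (Afeas s).Nonempty)
    (c : S → A → ℝ) (y : S → A → ℝ) (hy : ∀ s a, 0 < y s a)
    (m : S → A → S → ℝ) (hm0 : ∀ s a j, 0 ≤ m s a j)
    (hm1 : ∀ s a, ∑ j, m s a j = 1)
    (g : ℝ) (h : S → ℝ)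
    (hopt : ∀ s, h s = (Afeas s).inf' (hAfeas s)
      (fun a => c s a - g * y s a + ∑ j, m s a j * h j))
    (π : S → A) (hπ : ∀ s, π s ∈ Afeas s)
    (μ : S → ℝ) (hμ0 : ∀ s, 0 ≤ μ s) (hμ1 : ∑ s, μ s = 1)
    (hinv : ∀ j, ∑ s, μ s * m s (π s) j = μ j) :
    g * ∑ s, μ s * y s (π s) ≤ ∑ s, μ s * c s (π s) ∧
      g ≤ (∑ s, μ s * c s (π s)) / (∑ s, μ s * y s (π s)) := by
  have hle : ∀ s, h s ≤ c s (π s) - g * y s (π s) + ∑ j, m s (π s) j * h j := fun s =>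
    (hopt s).le.trans (Finset.inf'_le _ (hπ s))
  have hbalance : ∑ s, μ s * ∑ j, m s (π s) j * h j = ∑ j, μ j * h j := by
    simp_rw [Finset.mul_sum]
    rw [Finset.sum_comm]
    refine Finset.sum_congr rfl fun j _ => ?_
    rw [← hinv j, Finset.sum_mul]
    exact Finset.sum_congr rfl fun s _ => (mul_assoc _ _ _).symm
  have hbound : g * ∑ s, μ s * y s (π s) ≤ ∑ s, μ s * c s (π s) := by
    have hsum := Finset.sum_le_sum fun s (_ : s ∈ Finset.univ) =>
      mul_le_mul_of_nonneg_left (hle s) (hμ0 s)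
    simp only [mul_add, mul_sub, Finset.sum_add_distrib, Finset.sum_sub_distrib,
      mul_left_comm _ g, ← Finset.mul_sum] at hsum
    linarith
  have hpos : 0 < ∑ s, μ s * y s (π s) := by
    obtain ⟨s, hs, hμs⟩ := Finset.exists_lt_of_sum_lt
      (show ∑ _s : S, (0 : ℝ) < ∑ s, μ s by simp [hμ1])
    exact Finset.sum_pos' (fun s _ => mul_nonneg (hμ0 s) (hy s _).le)
      ⟨s, hs, mul_pos hμs (hy s _)⟩
  exact ⟨hbound, (le_div_iff₀ hpos).2 hbound⟩
end

section
/- Let S be a finite nonempty state space and A a finite action space; for each s ∈ S let A_s ⊆ A be a nonempty set of feasible actions; let c(s,a) ∈ ℝ be expected costs, y(s,a) > 0 expected sojourn times, and m(j|s,a) ≥ 0 with ∑_{j∈S} m(j|s,a) = 1 transition probabilities. Suppose g ∈ ℝ and h : S → ℝ satisfy the SMDP optimality equations h(s) = min_{a ∈ A_s} { c(s,a) - g·y(s,a) + ∑_{j∈S} m(j|s,a)·h(j) } for all s ∈ S, and let π : S → A with π(s) ∈ A_s attain the minimum at every state, i.e., h(s) = c(s,π(s)) - g·y(s,π(s)) +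 ∑_j m(j|s,π(s))·h(j) for all s. If μ : S → ℝ satisfies μ(s) ≥ 0, ∑_s μ(s) = 1, and ∑_s μ(s)·m(j|s,π(s)) = μ(j) for all j ∈ S, then g·∑_s μ(s)·y(s,π(s)) = ∑_s μ(s)·c(s,π(s)); i.e., the minimizing policy π achieves average cost per unit time exactly g. -/
open Finset

/-- Attainment half of Proposition 2 in the finite-state setting: a policy
attaining the minimum in the average-cost SMDP optimality equations achieves
average cost per unit time exactly g. -/
theorem stmt_10 {S A : Type*} [Fintype S] [Nonempty S] [Fintype A]
    (Afeas : S → Finset A) (hAfeas : ∀ s, (Afeas s).Nonempty)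
    (c : S → A → ℝ) (y : S → A → ℝ) (hy : ∀ s a, 0 < y s a)
    (m : S → A → S → ℝ) (hm0 : ∀ s a j, 0 ≤ m s a j)
    (hm1 : ∀ s a, ∑ j, m s a j = 1)
    (g : ℝ) (h : S → ℝ)
    (hopt : ∀ s, h s = (Afeas s).inf' (hAfeas s)
      (fun a => c s a - g * y s a + ∑ j, m s a j * h j))
    (π : S → A) (hπ : ∀ s, π s ∈ Afeas s)
    (hmin : ∀ s, h s = c s (π s) - g * y s (π s) + ∑ j, m s (π s) j * h j)
    (μ : S → ℝ) (hμ0 : ∀ s, 0 ≤ μ s) (hμ1 : ∑ s, μ s = 1)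
    (hinv : ∀ j, ∑ s, μ s * m s (π s) j = μ j) :
    g * ∑ s, μ s * y s (π s) = ∑ s, μ s * c s (π s) := by
  have hswap : ∑ s, μ s * ∑ j, m s (π s) j * h j = ∑ s, μ s * h s := by
    simp_rw [Finset.mul_sum, ← mul_assoc]
    rw [Finset.sum_comm]
    simp_rw [← Finset.sum_mul, hinv]
  have hsum : ∑ s, μ s * h s = ∑ s, μ s * c s (π s) - g * ∑ s, μ s * y s (π s)
      + ∑ s, μ s * ∑ j, m s (π s) j * h j := by
    rw [Finset.mul_sum, ← Finset.sum_sub_distrib, ← Finset.sum_add_distrib]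
    refine Finset.sum_congr rfl fun s _ => ?_
    linear_combination μ s * hmin s
  linarith
end
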